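/- Safety of GP with a stored family of random permutations (non-asymptotic form of the derandomization theorem): let n ≥ 2, ε = √(ln n/(n−1)), f : ℕ with (f : ℝ) < (n−1)(1−ε), p = 1 − f/(n−1), and let c > 1 be such that q := (n³/(n²−1))·exp(−((c−1)²/(2c))(⌈log₂(n−1)⌉−1)) satisfies q < n^(−2); set T = (c/(p−ε))·(⌈log₂(n−1)⌉+1). Let t : ℕ and δ : ℝ satisfy δ > e/n and δ·t ≥ 2n/log₂ n (log₂ over the reals). For a permutation π of Fin (n−1) and a set F ⊆ Fin (n−1), define the failure pattern b(π,F) : ℕ → Bool by b(π,F) i = decide (π ⟨i,h⟩ ∉ F) for i < n−1 and b(π,F) i = true for i ≥ n−1, and define Runtime(π,F) = HGP (n−1) (b(π,F)). Then, with respect to the uniform probability measure on t-tuples (π¹, …, π^t) of permutations of Fin (n−1), the probability of the event 'there exists a set F ⊆ Fin (n−1) with |F| = f such that the number of indices i ∈ [t] with T < Runtime(πⁱ, F) exceeds δ·t' is at most 2·2^(−n). In other words, t independent uniformly random permutations are, with probability at least 1 − 2·2^(−n), (f, 1−δ, T)-safe: for every failure set F of size f, a uniformly random index i ∈ [t] yields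 Runtime(πⁱ,F) ≤ T with probability at least 1−δ. -/

import Mathlib

def tailSeq (b : ℕ → Bool) : ℕ → Bool := fun i => b (i+1)
def oddSeq (b : ℕ → Bool) : ℕ → Bool := fun i => b (2*i)
def evenSeq (b : ℕ → Bool) : ℕ → Bool := fun i => b (2*i+1)

/-- Time complexity of the GP algorithm with `n` uninformed processors under
failure pattern `b` (`b i = true` means the `i`-th request is successful). -/
def HGP : ℕ → (ℕ → Bool) → ℕ
  | 0, _ => 0
  | n+1, b =>
    if b 0 then
      1 + max (HGP ((n+1)/2) (oddSeq (tailSeq b))) (HGP (n/2) (evenSeq (tailSeq b)))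
    else
      1 + HGP n (tailSeq b)
decreasing_by all_goals omega

/-- The failure pattern seen by the GP algorithm when the `n-1` non-start
processors are permuted by `π` and the processors in `F` are crashed:
the `i`-th request succeeds iff the `i`-th processor of the permuted list is
not in `F` (all requests beyond the list succeed vacuously). -/
def bPattern (m : ℕ) (π : Equiv.Perm (Fin m)) (F : Finset (Fin m)) : ℕ → Bool :=
  fun i => if h : i < m then decide (π ⟨i, h⟩ ∉ F) else true

/-- Permutations of a finite type carry the discrete σ-algebra. -/
instance (m : ℕ) : MeasurableSpace (Equiv.Perm (Fin m)) := ⊤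

theorem gp_succ_true (n : ℕ) (b : ℕ → Bool) (h : b 0 = true) : HGP (n+1) b =
    1 + max (HGP ((n+1)/2) (oddSeq (tailSeq b))) (HGP (n/2) (evenSeq (tailSeq b))) := by
  rw [HGP]; simp [h]

theorem gp_succ_false (n : ℕ) (b : ℕ → Bool) (h : b 0 = false) : HGP (n+1) b =
    1 + HGP n (tailSeq b) := by
  rw [HGP]; simp [h]

theorem gp_zero (b : ℕ → Bool) : HGP 0 b = 0 := by rw [HGP]

theorem gp_odd_even (m : ℕ) : ∀ x : ℕ → Bool, HGP ((m+1)/2) (oddSeq x) ≤ HGP m x ∧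
    HGP (m/2) (evenSeq x) ≤ HGP m x := by
  induction m using Nat.strong_induction_on with
  | _ m ih =>
    intro x
    rcases m with _ | m
    · simp [gp_zero]
    · have e1 : (m+1+1)/2 = m/2+1 := by omega
      have e2 : tailSeq (oddSeq x) = evenSeq (tailSeq x) := by
        funext i; simp only [tailSeq, oddSeq, evenSeq]; congr 1
      have e3 : evenSeq x = oddSeq (tailSeq x) := by
        funext i; simp only [tailSeq, oddSeq, evenSeq]
      have e4 : oddSeq x 0 = x 0 := by simp [oddSeq]
      have i1 := ih m (by omega) (tailSeq x)
      have i2 := ih (m/2) (by omega) (evenSeq (tailSeq x))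
      rw [e1, e3]
      rcases hx : x 0 with _ | _
      · rw [gp_succ_false _ _ hx, gp_succ_false _ _ (e4.trans hx), e2]
        omega
      · rw [gp_succ_true _ _ hx, gp_succ_true _ _ (e4.trans hx), e2]
        omega

theorem gp_mono (m : ℕ) : ∀ b b' : ℕ → Bool, (∀ i, b' i = true → b i = true) →
    HGP m b ≤ HGP m b' := by
  induction m using Nat.strong_induction_on with
  | _ m ih =>
    intro b b' h
    rcases m with _ | m
    · simp [gp_zero]
    · have i0 := ih m (by omega) (tailSeq b) (tailSeq b') (fun i => h _)
      rcases hx : b' 0 with _ | _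
      · rw [gp_succ_false _ _ hx]
        rcases hy : b 0 with _ | _
        · rw [gp_succ_false _ _ hy]; omega
        · rw [gp_succ_true _ _ hy]
          have := gp_odd_even m (tailSeq b)
          omega
      · rw [gp_succ_true _ _ hx, gp_succ_true _ _ (h 0 hx)]
        have i1 := ih ((m+1)/2) (by omega) (oddSeq (tailSeq b)) (oddSeq (tailSeq b')) (fun i => h _)
        have i2 := ih (m/2) (by omega) (evenSeq (tailSeq b)) (evenSeq (tailSeq b')) (fun i => h _)
        omega

theorem clog_step (a m : ℕ) (h : 2 * a ≤ m + 1) : Nat.clog 2 (a+1) + 1 ≤ Nat.clog 2 (m+1+1) := by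
  obtain ⟨k, hk⟩ : ∃ k, Nat.clog 2 (m+1+1) = k + 1 := by
    have : 0 < Nat.clog 2 (m+1+1) := Nat.clog_pos (by norm_num) (by omega)
    exact ⟨_, (Nat.succ_pred_eq_of_pos this).symm⟩
  have h1 : m+1+1 ≤ 2^(k+1) := by rw [← hk]; exact Nat.le_pow_clog (by norm_num) _
  rw [hk]
  have : Nat.clog 2 (a+1) ≤ k := Nat.clog_le_of_le_pow (by rw [pow_succ] at h1; omega)
  omega

theorem gp_bern (p c z : ℝ) (hp0 : 0 ≤ p) (hp1 : p ≤ 1) (hc : 1 ≤ c) (hz0 : 1 ≤ z)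
    (hz : z * (1 - p + p / c) = 1) (m : ℕ) :
    ∀ (e : ℕ → ℕ) (s : Finset ℕ), Function.Injective e → (∀ i < m, e i ∈ s) →
    ∑ S ∈ s.powerset, (1-p)^S.card * p^(s.card - S.card) * z^(HGP m (fun i => decide (e i ∉ S)))
      ≤ (m+1 : ℝ) * c^(Nat.clog 2 (m+1)) := by
  induction m using Nat.strong_induction_on with
  | _ m ih =>
    intro e s he hs
    rcases m with _ | m
    · simp only [gp_zero, pow_zero, mul_one]
      rw [Finset.sum_pow_mul_eq_add_pow]
      simp
    · have h0 : e 0 ∈ s := hs 0 (by omega)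
      obtain ⟨s', hs0, rfl⟩ : ∃ s', e 0 ∉ s' ∧ s = insert (e 0) s' :=
        ⟨s.erase (e 0), by simp, by rw [Finset.insert_erase h0]⟩
      have hmem : ∀ i, i + 1 < m + 1 → e (i+1) ∈ s' := by
        intro i hi
        have := hs (i+1) hi
        rw [Finset.mem_insert] at this
        rcases this with h | h
        · have := he h; omega
        · exact h
      have I0 := ih m (by omega) (fun i => e (i+1)) s' (fun a b h => by have := he h; omega)
        (fun i hi => hmem i (by omega))
      have I1 := ih ((m+1)/2) (by omega) (fun i => e (2*i+1)) s'
        (fun a b h => by have := he h; omega)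
        (fun i hi => hmem (2*i) (by omega))
      have I2 := ih (m/2) (by omega) (fun i => e (2*i+1+1)) s'
        (fun a b h => by have := he h; omega)
        (fun i hi => hmem (2*i+1) (by omega))
      rw [Finset.sum_powerset_insert hs0]
      have A : ∑ S ∈ s'.powerset, (1-p)^S.card * p^((insert (e 0) s').card - S.card) *
            z^(HGP (m+1) (fun i => decide (e i ∉ S)))
          ≤ z * p * (∑ S ∈ s'.powerset, (1-p)^S.card * p^(s'.card - S.card) *
              z^(HGP ((m+1)/2) (fun i => decide (e (2*i+1) ∉ S)))
            + ∑ S ∈ s'.powerset, (1-p)^S.card * p^(s'.card - S.card) *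
              z^(HGP (m/2) (fun i => decide (e (2*i+1+1) ∉ S)))) := by
        rw [← Finset.sum_add_distrib, Finset.mul_sum]
        apply Finset.sum_le_sum
        intro S hS
        rw [Finset.mem_powerset] at hS
        have hc1 := Finset.card_le_card hS
        have h1 : (insert (e 0) s').card - S.card = (s'.card - S.card) + 1 := by
          rw [Finset.card_insert_of_notMem hs0]; omega
        have h2 : HGP (m+1) (fun i => decide (e i ∉ S)) =
            1 + max (HGP ((m+1)/2) (fun i => decide (e (2*i+1) ∉ S)))
              (HGP (m/2) (fun i => decide (e (2*i+1+1) ∉ S))) :=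
          gp_succ_true m _ (by simpa using fun h => hs0 (hS h))
        rw [h1, h2]
        generalize HGP ((m+1)/2) (fun i => decide (e (2*i+1) ∉ S)) = x
        generalize HGP (m/2) (fun i => decide (e (2*i+1+1) ∉ S)) = y
        have h3 : z^(max x y) ≤ z^x + z^y := by
          have : 0 ≤ z^x := by positivity
          have : 0 ≤ z^y := by positivity
          rcases max_choice x y with h | h <;> rw [h] <;> linarith
        have h4 : 0 ≤ (1-p)^S.card := pow_nonneg (by linarith) _
        calc _ = (z * p * (1-p)^S.card * p^(s'.card - S.card)) * z^(max x y) := by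
              rw [pow_add, pow_succ]; ring
          _ ≤ (z * p * (1-p)^S.card * p^(s'.card - S.card)) * (z^x + z^y) := by
              apply mul_le_mul_of_nonneg_left h3; positivity
          _ = _ := by ring
      have B : ∑ S ∈ s'.powerset, (1-p)^(insert (e 0) S).card *
            p^((insert (e 0) s').card - (insert (e 0) S).card) *
            z^(HGP (m+1) (fun i => decide (e i ∉ insert (e 0) S)))
          = z * (1-p) * (∑ S ∈ s'.powerset, (1-p)^S.card * p^(s'.card - S.card) *
              z^(HGP m (fun i => decide (e (i+1) ∉ S)))) := by
        rw [Finset.mul_sum]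
        apply Finset.sum_congr rfl
        intro S hS
        rw [Finset.mem_powerset] at hS
        have h2 : HGP (m+1) (fun i => decide (e i ∉ insert (e 0) S)) =
            1 + HGP m (fun i => decide (e (i+1) ∉ S)) := by
          rw [gp_succ_false m _ (by simp)]
          congr 2
          funext i
          have : e (i+1) ≠ e 0 := fun h => by have := he h; omega
          simp [tailSeq, this]
        rw [h2, Finset.card_insert_of_notMem hs0, Finset.card_insert_of_notMem (fun h => hs0 (hS h)),
          Nat.add_sub_add_right, pow_add, pow_succ]
        ring
      have hc0 : 0 < c := by linarith
      set k := Nat.clog 2 (m+1+1) with hk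
      have C0 : (m+1:ℝ) * c^(Nat.clog 2 (m+1)) ≤ (m+1+1) * c^k := by
        have := Nat.clog_mono_right 2 (show m+1 ≤ m+1+1 by omega)
        have := pow_le_pow_right₀ hc this
        gcongr
        linarith
      have C (a : ℕ) (ha : 2 * a ≤ m+1) : c^(Nat.clog 2 (a+1)) ≤ c^k / c := by
        rw [le_div_iff₀ hc0, ← pow_succ]
        exact pow_le_pow_right₀ hc (clog_step a m ha)
      have C1 : (((m+1)/2 : ℕ)+1:ℝ) * c^(Nat.clog 2 ((m+1)/2+1)) ≤ (((m+1)/2 : ℕ)+1:ℝ) * (c^k/c) := by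
        gcongr; exact C _ (by omega)
      have C2 : ((m/2 : ℕ)+1:ℝ) * c^(Nat.clog 2 (m/2+1)) ≤ ((m/2 : ℕ)+1:ℝ) * (c^k/c) := by
        gcongr; exact C _ (by omega)
      have hsum : (((m+1)/2 : ℕ) : ℝ) + ((m/2 : ℕ) : ℝ) = m := by
        rw [← Nat.cast_add]; congr 1; omega
      have hzp : 0 ≤ z * p := by positivity
      have hzu : 0 ≤ z * (1-p) := mul_nonneg (by linarith) (by linarith)
      rw [B]
      push_cast
      calc _ ≤ z * p * ((((m+1)/2 : ℕ)+1:ℝ) * (c^k/c) + ((m/2 : ℕ)+1:ℝ) * (c^k/c))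
            + z * (1-p) * ((m+1+1) * c^k) := by
            refine add_le_add (A.trans ?_) ?_
            · exact mul_le_mul_of_nonneg_left (add_le_add (I1.trans C1) (I2.trans C2)) hzp
            · exact mul_le_mul_of_nonneg_left (I0.trans C0) hzu
        _ = z * p * (((((m+1)/2 : ℕ) : ℝ) + ((m/2 : ℕ) : ℝ) + 1 + 1) * (c^k/c))
            + z * (1-p) * ((m+1+1) * c^k) := by ring
        _ = (z * (1 - p + p / c)) * ((m+1+1) * c^k) := by rw [hsum]; ring
        _ = _ := by rw [hz, one_mul]

/-- averaging over permutations -/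
theorem perm_avg {α : Type*} [Fintype α] [DecidableEq α] (Bad : Finset α → Prop) [DecidablePred Bad]
    (hBad : ∀ S S', S ⊆ S' → Bad S → Bad S') (w : ℕ → ℝ) (hw : ∀ k, 0 ≤ w k) (F : Finset α) :
    (∑ G : Finset α, if F.card ≤ G.card then w G.card else 0) *
      ((Finset.univ.filter (fun π : Equiv.Perm α => Bad (F.map π.symm.toEmbedding))).card : ℝ)
    ≤ (Fintype.card (Equiv.Perm α) : ℝ) * ∑ G : Finset α, if Bad G then w G.card else 0 := by
  have key (G : Finset α) (hG : F.card ≤ G.card) :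
      (Finset.univ.filter (fun π : Equiv.Perm α => Bad (F.map π.symm.toEmbedding))).card ≤
      (Finset.univ.filter (fun π : Equiv.Perm α => Bad (G.map π.symm.toEmbedding))).card := by
    obtain ⟨G', hG', hcard⟩ := Finset.exists_subset_card_eq hG
    obtain ⟨σ, hσ⟩ : ∃ σ : Equiv.Perm α, F.map σ.toEmbedding = G' := by
      let e0 : {x // x ∈ F} ≃ {x // x ∈ G'} := Fintype.equivOfCardEq (by simp [hcard])
      refine ⟨e0.extendSubtype, ?_⟩
      apply Finset.eq_of_subset_of_card_le
      · intro x hx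
        rw [Finset.mem_map] at hx
        obtain ⟨a, ha, rfl⟩ := hx
        exact e0.extendSubtype_mem a ha
      · simp [hcard]
    apply Finset.card_le_card_of_injOn (fun π => σ * π)
    · intro π hπ
      simp only [Finset.coe_filter, Finset.mem_univ, true_and, Set.mem_ofPred_eq] at hπ ⊢
      refine hBad _ _ ?_ hπ
      intro x hx
      rw [Finset.mem_map_equiv] at hx ⊢
      apply hG'
      rw [← hσ, Finset.mem_map_equiv]
      simpa using hx
    · intro a _ b _ h
      exact mul_left_cancel h
  have h1 (π : Equiv.Perm α) : ∑ G : Finset α, (if Bad G then w G.card else 0) =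
      ∑ G : Finset α, (if Bad (G.map π.symm.toEmbedding) then w G.card else 0) := by
    rw [← Equiv.sum_comp (Equiv.finsetCongr π.symm)]
    apply Finset.sum_congr rfl
    intro G _
    simp
  have h2 : (Fintype.card (Equiv.Perm α) : ℝ) * ∑ G : Finset α, (if Bad G then w G.card else 0) =
      ∑ G : Finset α, w G.card *
        ((Finset.univ.filter (fun π : Equiv.Perm α => Bad (G.map π.symm.toEmbedding))).card : ℝ) := by
    rw [← nsmul_eq_mul, ← Finset.card_univ, ← Finset.sum_const, Finset.sum_congr rfl (fun π _ => h1 π),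
      Finset.sum_comm]
    apply Finset.sum_congr rfl
    intro G _
    rw [← Finset.sum_filter, Finset.sum_const, nsmul_eq_mul, mul_comm]
  rw [h2, Finset.sum_mul]
  apply Finset.sum_le_sum
  intro G _
  split_ifs with h
  · exact mul_le_mul_of_nonneg_left (by exact_mod_cast key G h) (hw _)
  · rw [zero_mul]; exact mul_nonneg (hw _) (by positivity)

/-- lower tail of the binomial distribution -/
theorem binom_tail {α : Type*} [Fintype α] [DecidableEq α] (u ε : ℝ) (f : ℕ) (hu0 : 0 ≤ u) (hu1 : u ≤ 1)
    (hε : 0 ≤ ε) (hf : (f:ℝ) = (Fintype.card α) * (u - ε)) :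
    1 - Real.exp (-(Fintype.card α * ε^2 / 2)) ≤
    ∑ G : Finset α, if f ≤ G.card then u^G.card * (1-u)^(Fintype.card α - G.card) else 0 := by
  set m := Fintype.card α with hm
  have tot (a b : ℝ) : ∑ G : Finset α, a^G.card * b^(m - G.card) = (a+b)^m := by
    have := Finset.sum_pow_mul_eq_add_pow a b (Finset.univ : Finset α)
    simpa using this
  have t1 := tot u (1-u)
  rw [show u + (1-u) = 1 by ring, one_pow] at t1
  have t2 := tot (u * Real.exp (-ε)) (1-u)
  have hsplit : (∑ G : Finset α, u^G.card * (1-u)^(m - G.card)) ≤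
      (∑ G : Finset α, if f ≤ G.card then u^G.card * (1-u)^(m - G.card) else 0) +
      Real.exp (ε * f) * ∑ G : Finset α, (u * Real.exp (-ε))^G.card * (1-u)^(m - G.card) := by
    rw [Finset.mul_sum, ← Finset.sum_add_distrib]
    apply Finset.sum_le_sum
    intro G _
    have hpos : 0 ≤ u^G.card * (1-u)^(m - G.card) := 
      mul_nonneg (pow_nonneg hu0 _) (pow_nonneg (by linarith) _)
    have hrw : Real.exp (ε * f) * ((u * Real.exp (-ε))^G.card * (1-u)^(m - G.card)) =
        Real.exp (ε * (f - G.card)) * (u^G.card * (1-u)^(m - G.card)) := by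
      rw [mul_pow, ← Real.exp_nat_mul, show ε * ((f:ℝ) - G.card) = ε * f + G.card * -ε by ring,
        Real.exp_add]
      ring
    rw [hrw]
    split_ifs with h
    · have := mul_nonneg (Real.exp_pos (ε * (f - G.card))).le hpos
      linarith
    · have h3 : (G.card : ℝ) ≤ f := by exact_mod_cast (by omega : G.card ≤ f)
      have h4 : 1 ≤ Real.exp (ε * (f - G.card)) := Real.one_le_exp (mul_nonneg hε (by linarith))
      nlinarith
  rw [t1, t2] at hsplit
  have hq : 1 - ε ≤ Real.exp (-ε) ∧ Real.exp (-ε) ≤ 1 - ε + ε^2/2 := by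
    refine ⟨by linarith [Real.add_one_le_exp (-ε)], ?_⟩
    have h5 : 1 + ε + ε^2/2 ≤ Real.exp ε := Real.quadratic_le_exp_of_nonneg hε
    rw [Real.exp_neg]
    have : (Real.exp ε)⁻¹ ≤ (1 + ε + ε^2/2)⁻¹ := by gcongr
    refine this.trans ?_
    rw [inv_le_iff_one_le_mul₀ (by positivity)]
    nlinarith [sq_nonneg (ε^2)]
  have h6 : (u * Real.exp (-ε) + (1-u))^m ≤ Real.exp (m * (u * (-ε + ε^2/2))) := by
    rw [Real.exp_nat_mul]
    apply pow_le_pow_left₀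
    · have := mul_nonneg hu0 (Real.exp_pos (-ε)).le
      linarith
    · have := Real.add_one_le_exp (u * (-ε + ε^2/2))
      nlinarith
  have h7 : Real.exp (ε * f) * (u * Real.exp (-ε) + (1-u))^m ≤ Real.exp (-(m * ε^2 / 2)) := by
    calc _ ≤ Real.exp (ε * f) * Real.exp (m * (u * (-ε + ε^2/2))) := by gcongr
      _ = Real.exp (ε * f + m * (u * (-ε + ε^2/2))) := by rw [Real.exp_add]
      _ ≤ _ := by
        apply Real.exp_le_exp.mpr
        rw [hf]
        have : 0 ≤ (m:ℝ) * ε^2 * (1-u) := mul_nonneg (by positivity) (by linarith)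
        nlinarith
  linarith

theorem chernoff_count {Ω : Type*} [Fintype Ω] (B : Ω → Prop) [DecidablePred B] (a y d : ℝ)
    (hy : 1 ≤ y) (ha : 0 ≤ a)
    (hB : ((Finset.univ.filter B).card : ℝ) ≤ Fintype.card Ω * a) (t : ℕ)
    (E : Finset (Fin t → Ω))
    (hE : ∀ π ∈ E, d < ((Finset.univ.filter (fun i => B (π i))).card : ℝ)) :
    (E.card : ℝ) * y^d ≤ (Fintype.card Ω : ℝ)^t * Real.exp (t * (a * y)) := by
  have hy0 : 0 < y := by linarith
  have h1 : (E.card : ℝ) * y^d ≤ ∑ π : Fin t → Ω, ∏ i, (if B (π i) then y else 1) := by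
    rw [← nsmul_eq_mul, ← Finset.sum_const]
    refine (Finset.sum_le_sum ?_).trans
      (Finset.sum_le_sum_of_subset_of_nonneg (Finset.subset_univ E) ?_)
    · intro π hπ
      rw [Finset.prod_ite]
      simp only [Finset.prod_const, one_pow, mul_one]
      rw [← Real.rpow_natCast]
      exact Real.rpow_le_rpow_of_exponent_le hy (hE π hπ).le
    · intro π _ _
      apply Finset.prod_nonneg
      intro i _
      split_ifs <;> linarith
  rw [← Fintype.sum_pow (fun ω : Ω => if B ω then y else 1)] at h1
  refine h1.trans ?_
  rw [Real.exp_nat_mul, ← mul_pow]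
  apply pow_le_pow_left₀
  · apply Finset.sum_nonneg
    intro i _
    split_ifs <;> linarith
  · have h2 : ∑ ω : Ω, (if B ω then y else 1) =
        (Fintype.card Ω : ℝ) + ((Finset.univ.filter B).card : ℝ) * (y - 1) := by
      have : ∀ ω : Ω, (if B ω then y else 1) = 1 + (if B ω then (y-1) else 0) := by
        intro ω; split_ifs <;> ring
      rw [Finset.sum_congr rfl (fun ω _ => this ω), Finset.sum_add_distrib, ← Finset.sum_filter]
      simp only [Finset.sum_const, nsmul_eq_mul, mul_one, Finset.card_univ]
    rw [h2]
    have h3 := Real.add_one_le_exp (a * y)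
    have h4 := mul_le_mul_of_nonneg_right hB (show 0 ≤ y - 1 by linarith)
    have h5 : (0:ℝ) ≤ Fintype.card Ω := by positivity
    have h6 := mul_le_mul_of_nonneg_left h3 h5
    have h7 := mul_nonneg h5 ha
    nlinarith

theorem log_bound (c : ℝ) (hc : 1 ≤ c) :
    c * Real.exp (-(c-1)) ≤ Real.exp (-((c-1)^2/(2*c))) := by
  have hc0 : 0 < c := by linarith
  have h := Real.self_le_sinh_iff.mpr (Real.log_nonneg hc)
  rw [Real.sinh_eq, Real.exp_neg, Real.exp_log hc0] at h
  nth_rewrite 1 [← Real.exp_log hc0]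
  rw [← Real.exp_add]
  apply Real.exp_le_exp.mpr
  have : (c-1)^2/(2*c) = (c + c⁻¹)/2 - 1 := by field_simp; ring
  rw [this]
  linarith

theorem kappa_ge (m : ℕ) (hm : 1 ≤ m) (κ : ℝ)
    (hq : ((m:ℝ)+1) * Real.exp (-κ * ((Nat.clog 2 m : ℝ) - 1)) < (((m:ℝ)+1)^2)⁻¹) (hκ0 : 0 ≤ κ) :
    1 ≤ κ := by
  by_contra hlt
  push Not at hlt
  have hm1 : (1:ℝ) ≤ m := by exact_mod_cast hm
  have h1 : ((m:ℝ)+1)^3 < Real.exp (κ * ((Nat.clog 2 m : ℝ) - 1)) := by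
    rw [neg_mul, Real.exp_neg] at hq
    have he := Real.exp_pos (κ * ((Nat.clog 2 m : ℝ) - 1))
    rw [← div_eq_mul_inv, ← one_div, div_lt_div_iff₀ he (by positivity)] at hq
    nlinarith
  rcases Nat.eq_zero_or_pos (Nat.clog 2 m) with h0 | h0
  · rw [h0] at h1
    have : Real.exp (κ * (((0:ℕ):ℝ) - 1)) ≤ 1 := by
      apply Real.exp_le_one_iff.mpr; push_cast; linarith
    have : (1:ℝ) ≤ ((m:ℝ)+1)^3 := one_le_pow₀ (by linarith)
    linarith
  · obtain ⟨k, hk⟩ : ∃ k, Nat.clog 2 m = k + 1 := ⟨_, (Nat.succ_pred_eq_of_pos h0).symm⟩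
    have h2 : 2^k < m := by
      have hm2 : 1 < m := by
        by_contra h
        have : m = 1 := by omega
        rw [this] at h0; simp at h0
      have := Nat.pow_pred_clog_lt_self (b := 2) (by norm_num) hm2
      rwa [hk] at this
    have h2' : (2:ℝ)^k < m := by exact_mod_cast h2
    rw [hk] at h1
    have h3 : Real.exp (κ * (((k+1:ℕ):ℝ) - 1)) ≤ Real.exp k := by
      apply Real.exp_le_exp.mpr
      push_cast
      have : (0:ℝ) ≤ k := by positivity
      nlinarith
    have h4 : Real.exp k ≤ ((2:ℝ)^k)^2 := by
      rw [← Real.exp_one_pow, ← pow_mul, mul_comm, pow_mul]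
      apply pow_le_pow_left₀ (Real.exp_pos 1).le
      linarith [Real.exp_one_lt_d9]
    have h5 : ((2:ℝ)^k)^2 ≤ ((m:ℝ)+1)^2 := by
      apply pow_le_pow_left₀ (by positivity); linarith
    have h6 : ((m:ℝ)+1)^2 ≤ ((m:ℝ)+1)^3 := pow_le_pow_right₀ (by linarith) (by norm_num)
    linarith

theorem bPattern_eq (m : ℕ) (π : Equiv.Perm (Fin m)) (F : Finset (Fin m)) :
    bPattern m π F = fun i => decide (i ∉ (F.map π.symm.toEmbedding).map Fin.valEmbedding) := by
  funext i
  unfold bPattern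
  split_ifs with h
  · congr 1
    apply propext
    apply not_congr
    constructor
    · intro hh
      exact Finset.mem_map.mpr ⟨⟨i, h⟩, Finset.mem_map_equiv.mpr (by simpa using hh), rfl⟩
    · intro hh
      obtain ⟨a, ha, hai⟩ := Finset.mem_map.mp hh
      have : a = ⟨i, h⟩ := Fin.ext hai
      rw [Finset.mem_map_equiv, this] at ha
      simpa using ha
  · symm
    rw [decide_eq_true_iff]
    intro hh
    obtain ⟨a, ha, hai⟩ := Finset.mem_map.mp hh
    exact h (hai ▸ a.2)

open Classical in
theorem single_bound (m : ℕ) (hm : 1 ≤ m) (ε : ℝ) (hε : ε = Real.sqrt (Real.log ((m:ℝ)+1) / m))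
    (f : ℕ) (p : ℝ) (hp : p = 1 - f / m - ε) (hp0 : 0 < p) (c : ℝ) (hc : 1 < c)
    (hq : ((m:ℝ)+1) * Real.exp (-((c-1)^2/(2*c)) * ((Nat.clog 2 m : ℝ) - 1)) < (((m:ℝ)+1)^2)⁻¹)
    (T : ℝ) (hT : T = c / p * ((Nat.clog 2 m : ℝ) + 1))
    (F : Finset (Fin m)) (hF : F.card = f) :
    ((Finset.univ.filter (fun π : Equiv.Perm (Fin m) => T < (HGP m (bPattern m π F) : ℝ))).card : ℝ)
      ≤ Fintype.card (Equiv.Perm (Fin m)) * (((m:ℝ)+1)^2)⁻¹ := by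
  have hm1 : (1:ℝ) ≤ m := by exact_mod_cast hm
  have hm0 : (0:ℝ) < m := by linarith
  have hc0 : 0 < c := by linarith
  have hε0 : 0 ≤ ε := by rw [hε]; exact Real.sqrt_nonneg _
  have hlog : 0 ≤ Real.log ((m:ℝ)+1) := Real.log_nonneg (by linarith)
  have hε2 : (m:ℝ) * ε^2 = Real.log ((m:ℝ)+1) := by
    rw [hε, Real.sq_sqrt (by positivity)]; field_simp
  have hp1 : p ≤ 1 := by
    have : 0 ≤ (f:ℝ)/m := by positivity
    linarith
  set κ := (c-1)^2/(2*c) with hκ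
  have hκ0 : 0 ≤ κ := by positivity
  have hκ1 : 1 ≤ κ := kappa_ge m hm κ hq hκ0
  set L := Nat.clog 2 m with hL
  let Bad : Finset (Fin m) → Prop := fun S => 
    T < (HGP m (fun i => decide (i ∉ S.map Fin.valEmbedding)) : ℝ)
  have hBad : ∀ S S', S ⊆ S' → Bad S → Bad S' := by
    intro S S' hSS hS
    refine lt_of_lt_of_le hS ?_
    have := gp_mono m (fun i => decide (i ∉ S.map Fin.valEmbedding))
      (fun i => decide (i ∉ S'.map Fin.valEmbedding)) (by
        intro i
        simp only [decide_eq_true_iff]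
        exact fun h h' => h (Finset.map_subset_map.mpr hSS h'))
    exact_mod_cast this
  have P := perm_avg Bad hBad (fun k => (1-p)^k * p^(m-k))
    (fun k => mul_nonneg (pow_nonneg (by linarith) _) (pow_nonneg hp0.le _)) F
  have Tl := binom_tail (α := Fin m) (1-p) ε f (by linarith) (by linarith) hε0 (by
    rw [hp, Fintype.card_fin]; field_simp; ring)
  rw [Fintype.card_fin] at Tl
  simp only [sub_sub_cancel] at Tl
  have h14 : (1:ℝ)/4 ≤ 1 - Real.exp (-((m:ℝ) * ε^2 / 2)) := by
    have h1 : Real.exp (-((m:ℝ) * ε^2 / 2))^2 ≤ 1/2 := by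
      rw [hε2, ← Real.exp_nat_mul]
      rw [show ((2:ℕ):ℝ) * -(Real.log ((m:ℝ)+1) / 2) = -Real.log ((m:ℝ)+1) by push_cast; ring,
        Real.exp_neg, Real.exp_log (by linarith), inv_eq_one_div]
      apply one_div_le_one_div_of_le <;> linarith
    nlinarith [Real.exp_pos (-((m:ℝ) * ε^2 / 2))]
  -- Markov for the Bernoulli measure
  have hw : 0 < 1 - p + p / c := by
    have : 0 < p / c := by positivity
    linarith
  set x := 1 - p + p / c with hx
  have hx1 : x ≤ 1 := by
    have : p / c ≤ p := div_le_self hp0.le hc.le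
    linarith
  have hz1 : 1 ≤ x⁻¹ := (one_le_inv₀ hw).mpr hx1
  have Bn := gp_bern p c x⁻¹ hp0.le hp1 hc.le hz1 (inv_mul_cancel₀ hw.ne') m id (Finset.range m)
    Function.injective_id (fun i hi => Finset.mem_range.mpr hi)
  have M : ∑ G : Finset (Fin m), (if Bad G then (1-p)^G.card * p^(m-G.card) else 0) ≤
      x^T * (((m:ℝ)+1) * c^(Nat.clog 2 (m+1))) := by
    refine le_trans ?_ (mul_le_mul_of_nonneg_left Bn (Real.rpow_nonneg hw.le _))
    rw [Finset.mul_sum]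
    have inj : Set.InjOn (fun G : Finset (Fin m) => G.map Fin.valEmbedding) (Finset.univ : Finset (Finset (Fin m))) :=
      fun a _ b _ h => Finset.map_injective _ h
    refine le_trans ?_ (Finset.sum_le_sum_of_subset_of_nonneg
      (s := Finset.univ.image (fun G : Finset (Fin m) => G.map Fin.valEmbedding)) ?_ ?_)
    · rw [Finset.sum_image inj]
      apply Finset.sum_le_sum
      intro G _
      have hwt : 0 ≤ (1-p)^G.card * p^(m-G.card) :=
        mul_nonneg (pow_nonneg (by linarith) _) (pow_nonneg hp0.le _)
      simp only [Finset.card_map, Finset.card_range, id]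
      split_ifs with hb
      · have hb' : T < (HGP m (fun i => decide (i ∉ G.map Fin.valEmbedding)) : ℝ) := hb
        generalize HGP m (fun i => decide (i ∉ G.map Fin.valEmbedding)) = h at hb'
        have : 1 ≤ x^T * x⁻¹^h := by
          rw [inv_pow, ← Real.rpow_natCast x h, ← Real.rpow_neg hw.le, ← Real.rpow_add hw]
          exact Real.one_le_rpow_of_pos_of_le_one_of_nonpos hw hx1 (by linarith)
        nlinarith
      · have : 0 ≤ x^T := Real.rpow_nonneg hw.le _
        positivity
    · intro S hS
      obtain ⟨G, _, rfl⟩ := Finset.mem_image.mp hS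
      rw [Finset.mem_powerset]
      intro i hi
      obtain ⟨a, _, rfl⟩ := Finset.mem_map.mp hi
      exact Finset.mem_range.mpr a.2
    · intro S _ _
      have : 0 ≤ x^T := Real.rpow_nonneg hw.le _
      have : 0 ≤ (1-p)^S.card := pow_nonneg (by linarith) _
      positivity
  have hLm : Nat.clog 2 (m+1) ≤ L + 1 := by
    apply Nat.clog_le_of_le_pow
    have : m ≤ 2^L := Nat.le_pow_clog (by norm_num) _
    rw [pow_succ]; omega
  have hT0 : 0 ≤ T := by rw [hT]; positivity
  have hxT : x^T ≤ Real.exp (-(c-1))^(L+1) := by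
    have h1 : x ≤ Real.exp (-(p * (1 - 1/c))) := by
      have := Real.add_one_le_exp (-(p * (1 - 1/c)))
      refine le_trans (le_of_eq ?_) this
      rw [hx]; ring
    calc x^T ≤ (Real.exp (-(p * (1 - 1/c))))^T := Real.rpow_le_rpow hw.le h1 hT0
      _ = Real.exp (-(c-1))^(L+1) := by
        rw [← Real.exp_mul, ← Real.exp_nat_mul, hT]
        congr 1
        push_cast
        field_simp
  have fin : x^T * (((m:ℝ)+1) * c^(Nat.clog 2 (m+1))) ≤ 1/4 * (((m:ℝ)+1)^2)⁻¹ := by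
    calc _ ≤ Real.exp (-(c-1))^(L+1) * (((m:ℝ)+1) * c^(L+1)) := by
          have := pow_le_pow_right₀ hc.le hLm
          gcongr
      _ = ((m:ℝ)+1) * (c * Real.exp (-(c-1)))^(L+1) := by rw [mul_pow]; ring
      _ ≤ ((m:ℝ)+1) * (Real.exp (-κ))^(L+1) := by
          have := log_bound c hc.le
          gcongr
      _ = Real.exp (-κ)^2 * (((m:ℝ)+1) * Real.exp (-κ * ((L:ℝ) - 1))) := by
          rw [← Real.exp_nat_mul, ← Real.exp_nat_mul, mul_left_comm, ← Real.exp_add]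
          congr 2; push_cast; ring
      _ ≤ 1/4 * (((m:ℝ)+1)^2)⁻¹ := by
          have h1 : Real.exp (-κ) ≤ 1/2 := by
            have : Real.exp (-κ) ≤ Real.exp (-1) := Real.exp_le_exp.mpr (by linarith)
            linarith [Real.exp_neg_one_lt_d9]
          have h2 : Real.exp (-κ)^2 ≤ 1/4 := by nlinarith [Real.exp_pos (-κ)]
          apply mul_le_mul h2 hq.le <;> positivity
  have hset : (Finset.univ.filter (fun π : Equiv.Perm (Fin m) => T < (HGP m (bPattern m π F) : ℝ))) =
      (Finset.univ.filter (fun π : Equiv.Perm (Fin m) => Bad (F.map π.symm.toEmbedding))) := by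
    apply Finset.filter_congr
    intro π _
    rw [bPattern_eq]
  rw [hset]
  rw [hF] at P
  set N := ((Finset.univ.filter (fun π : Equiv.Perm (Fin m) => Bad (F.map π.symm.toEmbedding))).card : ℝ) with hN
  have hN0 : 0 ≤ N := by positivity
  have hC0 : (0:ℝ) ≤ Fintype.card (Equiv.Perm (Fin m)) := by positivity
  have q1 := mul_le_mul_of_nonneg_right (h14.trans Tl) hN0
  have q2 := mul_le_mul_of_nonneg_left (M.trans fin) hC0
  linarith [q1.trans (P.trans q2)]

open MeasureTheory Classical in
/-- Safety of GP with a stored family of random permutations: `t` independent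
uniformly random permutations are, with probability at least `1 - 2·2⁻ⁿ`,
`(f, 1-δ, T)`-safe: except with probability `2·2⁻ⁿ` over the choice of the
tuple of permutations, for every failure set `F` of size `f`, the fraction of
indices `i` whose permutation yields a GP runtime exceeding `T` is at most `δ`. -/
theorem gp_stored_permutations_safe (n : ℕ) (hn : 2 ≤ n) (ε : ℝ)
    (hε : ε = Real.sqrt (Real.log n / ((n:ℝ) - 1)))
    (f : ℕ) (hf : (f : ℝ) < ((n:ℝ) - 1) * (1 - ε))
    (p : ℝ) (hp : p = 1 - (f : ℝ) / ((n:ℝ) - 1))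
    (c : ℝ) (hc : 1 < c)
    (q : ℝ)
    (hq : q = ((n:ℝ)^3 / ((n:ℝ)^2 - 1)) *
      Real.exp (-((c-1)^2 / (2*c)) * ((Nat.clog 2 (n-1) : ℝ) - 1)))
    (hqn : q < (n:ℝ)^(-2 : ℤ))
    (T : ℝ) (hT : T = c / (p - ε) * ((Nat.clog 2 (n-1) : ℝ) + 1))
    (t : ℕ) (δ : ℝ) (hδ : Real.exp 1 / n < δ)
    (hδt : 2 * (n:ℝ) / Real.logb 2 n ≤ δ * t) :
    (PMF.uniformOfFintype (Fin t → Equiv.Perm (Fin (n-1)))).toMeasure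
      {π | ∃ F : Finset (Fin (n-1)), F.card = f ∧
        δ * t < ((Finset.univ.filter (fun i : Fin t =>
          T < (HGP (n-1) (bPattern (n-1) (π i) F) : ℝ))).card : ℝ)} ≤
      ENNReal.ofReal (2 * (2:ℝ)^(-(n:ℤ))) := by
  obtain ⟨m, rfl⟩ : ∃ m, n = m + 1 := ⟨n-1, by omega⟩
  have hm : 1 ≤ m := by omega
  have hm1 : (1:ℝ) ≤ m := by exact_mod_cast hm
  have hm0 : (0:ℝ) < m := by linarith
  simp only [Nat.add_sub_cancel, Nat.cast_add, Nat.cast_one, add_sub_cancel_right] at hε hf hp hq hqn hT hδ hδt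
  have hpε : 0 < p - ε := by
    have : (f:ℝ)/m < 1 - ε := by rw [div_lt_iff₀ hm0]; linarith
    linarith
  have hq' : ((m:ℝ)+1) * Real.exp (-((c-1)^2/(2*c)) * ((Nat.clog 2 m : ℝ) - 1)) < (((m:ℝ)+1)^2)⁻¹ := by
    have h1 : (((m:ℝ)+1)^(-2:ℤ)) = (((m:ℝ)+1)^2)⁻¹ := by
      rw [zpow_neg]; norm_cast
    rw [← h1]
    refine lt_of_le_of_lt ?_ hqn
    rw [hq]
    apply mul_le_mul_of_nonneg_right _ (Real.exp_pos _).le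
    rw [le_div_iff₀ (by nlinarith)]
    nlinarith
  have SB := single_bound m hm ε hε f (p - ε) (by rw [hp]) hpε c hc hq' T hT
  set n' : ℝ := (m:ℝ) + 1 with hn'
  have hn2 : 2 ≤ n' := by linarith
  have hn0 : 0 < n' := by linarith
  set Ω := Equiv.Perm (Fin m) with hΩ
  set N : ℝ := (Fintype.card Ω : ℝ) with hN
  have hN0 : 0 < N := by rw [hN]; exact_mod_cast Fintype.card_pos
  -- bad tuples
  let E : Finset (Fin m) → Finset (Fin t → Ω) := fun F => Finset.univ.filter (fun π =>
    δ * t < ((Finset.univ.filter (fun i : Fin t =>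
          T < (HGP m (bPattern m (π i) F) : ℝ))).card : ℝ))
  have hpow : n' ^ (-(δ * t)) ≤ (2:ℝ)^(-(2*n')) := by
    have hl : 0 < Real.logb 2 n' := Real.logb_pos (by norm_num) (by linarith)
    have h1 : 2 * n' ≤ Real.logb 2 n' * (δ * t) := by
      rw [div_le_iff₀ hl] at hδt; linarith
    have h2 : n' = (2:ℝ)^(Real.logb 2 n') := (Real.rpow_logb (by norm_num) (by norm_num) hn0).symm
    nth_rewrite 1 [h2]
    rw [← Real.rpow_mul (by norm_num)]
    apply Real.rpow_le_rpow_of_exponent_le (by norm_num)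
    linarith
  have EB : ∀ F : Finset (Fin m), F.card = f → ((E F).card : ℝ) ≤ N^t * (2:ℝ)^(-(2*n')) := by
    intro F hF
    have he1 : 1 ≤ Real.exp 1 := Real.one_le_exp (by norm_num)
    have hy : 1 ≤ Real.exp 1 * n' := by nlinarith
    have := chernoff_count (fun π : Ω => T < (HGP m (bPattern m π F) : ℝ)) ((n'^2)⁻¹)
      (Real.exp 1 * n') (δ * t) hy (by positivity) (SB F hF) t (E F)
      (fun π hπ => by simpa [E] using hπ)
    have h1 : Real.exp (t * ((n'^2)⁻¹ * (Real.exp 1 * n'))) ≤ Real.exp (δ * t) := by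
      apply Real.exp_le_exp.mpr
      have : (n'^2)⁻¹ * (Real.exp 1 * n') = Real.exp 1 / n' := by field_simp
      rw [this, mul_comm]
      exact mul_le_mul_of_nonneg_right hδ.le (by positivity)
    have h2 : (Real.exp 1 * n')^(δ * t) = Real.exp (δ * t) * n'^(δ*t) := by
      rw [Real.mul_rpow (Real.exp_pos _).le hn0.le, ← Real.exp_mul, one_mul]
    rw [h2] at this
    have h3 : ((E F).card : ℝ) * n'^(δ*t) ≤ N^t := by
      have h4 := this.trans (mul_le_mul_of_nonneg_left h1 (pow_nonneg hN0.le t))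
      have h5 := Real.exp_pos (δ * t)
      refine le_of_mul_le_mul_right ?_ h5
      linarith
    have h6 : 0 < n'^(δ*t) := Real.rpow_pos_of_pos hn0 _
    calc ((E F).card : ℝ) ≤ N^t * n'^(-(δ*t)) := by
          rw [Real.rpow_neg hn0.le, ← div_eq_mul_inv, le_div_iff₀ h6]; exact h3
      _ ≤ _ := by gcongr
  let U : Finset (Fin t → Ω) := (Finset.univ.filter (fun F : Finset (Fin m) => F.card = f)).biUnion E
  have hU : (U.card : ℝ) ≤ N^t * (2 * (2:ℝ)^(-((m+1:ℕ):ℤ))) := by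
    calc (U.card : ℝ) ≤ ∑ F ∈ Finset.univ.filter (fun F : Finset (Fin m) => F.card = f), ((E F).card : ℝ) := by
          exact_mod_cast Finset.card_biUnion_le
      _ ≤ ∑ F ∈ Finset.univ.filter (fun F : Finset (Fin m) => F.card = f), N^t * (2:ℝ)^(-(2*n')) :=
          Finset.sum_le_sum (fun F hF => EB F (by simpa using hF))
      _ ≤ ∑ F : Finset (Fin m), N^t * (2:ℝ)^(-(2*n')) :=
          Finset.sum_le_sum_of_subset_of_nonneg (Finset.subset_univ _) (fun _ _ _ => by positivity)
      _ = N^t * ((2:ℝ)^m * (2:ℝ)^(-(2*n'))) := by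
          rw [Finset.sum_const, nsmul_eq_mul]; simp; ring
      _ ≤ _ := by
          apply mul_le_mul_of_nonneg_left _ (by positivity)
          rw [← Real.rpow_natCast, ← Real.rpow_intCast, ← Real.rpow_add (by norm_num)]
          have : (2:ℝ)^((m:ℝ) + -(2*n')) ≤ (2:ℝ)^(((-((m+1:ℕ):ℤ)):ℤ):ℝ) := by
            apply Real.rpow_le_rpow_of_exponent_le (by norm_num)
            push_cast; linarith
          have h0 : 0 < (2:ℝ)^(((-((m+1:ℕ):ℤ)):ℤ):ℝ) := by positivity
          linarith
  have hset : {π : Fin t → Ω | ∃ F : Finset (Fin m), F.card = f ∧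
        δ * t < ((Finset.univ.filter (fun i : Fin t =>
          T < (HGP m (bPattern m (π i) F) : ℝ))).card : ℝ)} = (U : Set (Fin t → Ω)) := by
    ext π
    simp [U, E]
  have : DiscreteMeasurableSpace Ω := ⟨fun _ => trivial⟩
  have hms : MeasurableSet (U : Set (Fin t → Ω)) := U.finite_toSet.measurableSet
  change (PMF.uniformOfFintype (Fin t → Ω)).toMeasure
      {π : Fin t → Ω | ∃ F : Finset (Fin m), F.card = f ∧
        δ * t < ((Finset.univ.filter (fun i : Fin t =>
          T < (HGP m (bPattern m (π i) F) : ℝ))).card : ℝ)} ≤ _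
  rw [hset, PMF.toMeasure_uniformOfFintype_apply _ hms]
  have hcardU : Fintype.card ((U : Set (Fin t → Ω)) : Type) = U.card := by
    simp
  have hcardT : (Fintype.card (Fin t → Ω) : ℝ) = N^t := by
    simp [hN]
  have hT0 : (0:ℝ) < Fintype.card (Fin t → Ω) := by rw [hcardT]; positivity
  rw [hcardU, ← ENNReal.ofReal_natCast U.card, ← ENNReal.ofReal_natCast (Fintype.card (Fin t → Ω)),
    ← ENNReal.ofReal_div_of_pos hT0]
  apply ENNReal.ofReal_le_ofReal
  rw [div_le_iff₀ hT0, hcardT]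
  push_cast at hU ⊢
  linarith
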